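/- Fix α ∈ (0,1) and set x_n = ⌊αn⌋. Let f̃_n denote the density of the standardized variable Z̃_n = √n·(α(1−α))^{−1/2}·(Z_n − α), where Z_n has density f_{n,x_n}, and let φ be the standard Gaussian density. Then the Kullback–Leibler divergence D(f̃_n ‖ φ) tends to 0 as n → ∞. -/

import Mathlib

open MeasureTheory Real Filter

/-- The Beta(x+1, n-x+1) posterior density `f_{n,x}` on `[0,1]`, extended by `0` outside. -/
noncomputable def betaDensity (n x : ℕ) (p : ℝ) : ℝ :=
  if 0 ≤ p ∧ p ≤ 1 then ((n : ℝ) + 1) * (n.choose x : ℝ) * p ^ x * (1 - p) ^ (n - x) else 0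

/-- The standard Gaussian density. -/
noncomputable def stdGaussianDensity (z : ℝ) : ℝ :=
  Real.exp (-z ^ 2 / 2) / Real.sqrt (2 * Real.pi)

/-- Density of the standardized variable `Z̃_n = √n (α(1-α))^{-1/2} (Z_n - α)` where `Z_n`
has density `f_{n, ⌊αn⌋}`. -/
noncomputable def tildeDensityAlpha (α : ℝ) (n : ℕ) (z : ℝ) : ℝ :=
  (Real.sqrt (α * (1 - α)) / Real.sqrt n) *
    betaDensity n (Nat.floor (α * n))
      (α + Real.sqrt (α * (1 - α)) / Real.sqrt n * z)

/-- Kullback–Leibler divergence `D(f‖g) = ∫ f log (f/g)`. -/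
noncomputable def klDiv (f g : ℝ → ℝ) : ℝ :=
  ∫ z : ℝ, f z * Real.log (f z / g z)

open scoped Nat Topology

theorem integral_pow_mul_one_sub_pow (a b : ℕ) :
    ∫ p in (0 : ℝ)..1, p ^ a * (1 - p) ^ b = (a ! * b ! : ℝ) / (a + b + 1)! := by
  induction b generalizing a with
  | zero => simp [Nat.factorial_succ]; field_simp
  | succ b ih =>
    have h := intervalIntegral.integral_deriv_eq_sub' (a := 0) (b := 1)
      (fun p : ℝ => p ^ (a + 1) * (1 - p) ^ (b + 1))
      (f' := fun p : ℝ => (a + 1) * (p ^ a * (1 - p) ^ (b + 1)) - (b + 1) * (p ^ (a + 1) * (1 - p) ^ b))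
      (by
        funext p
        have h1 : HasDerivAt (fun p : ℝ => p ^ (a + 1) * (1 - p) ^ (b + 1)) _ p :=
          (hasDerivAt_pow (a + 1) p).mul (((hasDerivAt_id p).const_sub 1).pow (b + 1))
        rw [h1.deriv]
        simp
        ring)
      (fun p _ => by fun_prop) (by fun_prop)
    rw [intervalIntegral.integral_sub (Continuous.intervalIntegrable (by fun_prop) _ _)
      (Continuous.intervalIntegrable (by fun_prop) _ _), intervalIntegral.integral_const_mul,
      intervalIntegral.integral_const_mul, ih (a + 1)] at h
    simp only [one_pow, sub_self, zero_pow (Nat.succ_ne_zero _), mul_zero, zero_mul] at h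
    have ha : (a + 1 : ℝ) ≠ 0 := by positivity
    rw [show a + 1 + b + 1 = a + (b + 1) + 1 by ring] at h
    apply mul_left_cancel₀ ha
    rw [sub_eq_zero.mp h, Nat.factorial_succ a, Nat.factorial_succ b]
    push_cast
    ring

theorem log_le_cubic {x : ℝ} (hx : 0 < x) :
    log x ≤ (x - 1) - (x - 1) ^ 2 / 2 + (x - 1) ^ 3 / 3 := by
  set g : ℝ → ℝ := fun t => (t - 1) - (t - 1) ^ 2 / 2 + (t - 1) ^ 3 / 3 - log t with hg
  have hd : ∀ t : ℝ, 0 < t → HasDerivAt g ((t - 1) ^ 3 / t) t := by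
    intro t ht
    have h1 := (hasDerivAt_id t).sub_const 1
    have h := ((h1.sub ((h1.pow 2).div_const 2)).add ((h1.pow 3).div_const 3)).sub
      (hasDerivAt_log ht.ne')
    refine h.congr_deriv ?_
    simp
    field_simp
    ring
  have h1 : g 1 = 0 := by simp [hg]
  suffices 0 ≤ g x by simpa [hg] using this
  rw [← h1]
  rcases le_total 1 x with h | h
  · refine monotoneOn_of_deriv_nonneg (convex_Ici 1) (f := g) ?_ ?_ ?_ (by simp) (by simpa) h
    · exact fun t ht => (hd t (one_pos.trans_le ht)).continuousAt.continuousWithinAt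
    · intro t ht
      rw [interior_Ici] at ht
      exact (hd t (one_pos.trans ht)).differentiableAt.differentiableWithinAt
    · intro t ht
      rw [interior_Ici] at ht
      have ht' : (1 : ℝ) < t := ht
      rw [(hd t (one_pos.trans ht)).deriv]
      exact div_nonneg (pow_nonneg (by linarith) 3) (by linarith)
  · refine antitoneOn_of_deriv_nonpos (convex_Ioc 0 1) (f := g) ?_ ?_ ?_ ⟨hx, h⟩ (by simp) h
    · exact fun t ht => (hd t ht.1).continuousAt.continuousWithinAt
    · intro t ht
      rw [interior_Ioc] at ht
      exact (hd t ht.1).differentiableAt.differentiableWithinAt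
    · intro t ht
      rw [interior_Ioc] at ht
      rw [(hd t ht.1).deriv]
      exact div_nonpos_of_nonpos_of_nonneg
        (Odd.pow_nonpos (by decide) (by linarith [ht.2])) ht.1.le

theorem betaDensity_nonneg (n x : ℕ) (p : ℝ) : 0 ≤ betaDensity n x p := by
  unfold betaDensity
  split_ifs with h
  · have := sub_nonneg.mpr h.2
    have := h.1
    positivity
  · rfl

theorem betaDensity_mul_eq_indicator (n x : ℕ) (g : ℝ → ℝ) :
    (fun p => betaDensity n x p * g p) = (Set.Icc (0 : ℝ) 1).indicator
      (fun p => ((n : ℝ) + 1) * (n.choose x : ℝ) * p ^ x * (1 - p) ^ (n - x) * g p) := by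
  funext p
  by_cases h : 0 ≤ p ∧ p ≤ 1 <;> simp [betaDensity, Set.indicator, h]

theorem integrable_betaDensity_mul (n x : ℕ) {g : ℝ → ℝ} (hg : Continuous g) :
    Integrable (fun p => betaDensity n x p * g p) := by
  rw [betaDensity_mul_eq_indicator]
  exact (Continuous.integrableOn_Icc (by fun_prop)).integrable_indicator measurableSet_Icc

theorem integral_betaDensity_mul_pow {n x : ℕ} (hx : x ≤ n) (k : ℕ) :
    ∫ p, betaDensity n x p * p ^ k =
      ((x + k)! * (n + 1)! : ℝ) / (x ! * (n + k + 1)!) := by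
  rw [betaDensity_mul_eq_indicator, integral_indicator measurableSet_Icc,
    integral_Icc_eq_integral_Ioc, ← intervalIntegral.integral_of_le zero_le_one]
  have : ∀ p : ℝ, ((n : ℝ) + 1) * (n.choose x : ℝ) * p ^ x * (1 - p) ^ (n - x) * p ^ k =
      (((n : ℝ) + 1) * (n.choose x : ℝ)) * (p ^ (x + k) * (1 - p) ^ (n - x)) := by
    intro p; ring
  simp_rw [this]
  rw [intervalIntegral.integral_const_mul, integral_pow_mul_one_sub_pow,
    Nat.cast_choose ℝ hx, Nat.factorial_succ n, show x + k + (n - x) + 1 = n + k + 1 by omega]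
  push_cast
  field_simp

/-- The expectation under the Beta posterior of a cubic polynomial centred at `x / n`. -/
theorem integral_betaDensity_mul_cubic {n x : ℕ} (hn : 0 < n) (hx : x ≤ n) {q y : ℝ}
    (hq : q = x / n) (hy : y = 1 / n) (c₀ c₁ c₂ c₃ : ℝ) :
    ∫ p, betaDensity n x p * (c₀ + n * (c₁ * (p - q) + c₂ * (p - q) ^ 2 + c₃ * (p - q) ^ 3)) =
      c₀ + c₁ * ((1 - 2 * q) / (1 + 2 * y))
        + c₂ * ((q * (1 - q) + y * (2 - 6 * q + 6 * q ^ 2)) / ((1 + 2 * y) * (1 + 3 * y)))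
        + c₃ * (y * (5 * q - 15 * q ^ 2 + 10 * q ^ 3 + y * (6 - 24 * q + 36 * q ^ 2 - 24 * q ^ 3))
          / ((1 + 2 * y) * (1 + 3 * y) * (1 + 4 * y))) := by
  have hexp : ∀ p : ℝ,
      betaDensity n x p * (c₀ + n * (c₁ * (p - q) + c₂ * (p - q) ^ 2 + c₃ * (p - q) ^ 3)) =
      (c₀ + n * (-c₁ * q + c₂ * q ^ 2 - c₃ * q ^ 3)) * (betaDensity n x p * p ^ 0)
        + (n * (c₁ - 2 * c₂ * q + 3 * c₃ * q ^ 2)) * (betaDensity n x p * p ^ 1)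
        + (n * (c₂ - 3 * c₃ * q)) * (betaDensity n x p * p ^ 2)
        + (n * c₃) * (betaDensity n x p * p ^ 3) := by
    intro p; ring
  simp_rw [hexp]
  have hj (k : ℕ) (c : ℝ) : Integrable fun p => c * (betaDensity n x p * p ^ k) :=
    (integrable_betaDensity_mul n x (continuous_pow k)).const_mul c
  rw [integral_add (by exact ((hj 0 _).add (hj 1 _)).add (hj 2 _)) (hj 3 _),
    integral_add (by exact (hj 0 _).add (hj 1 _)) (hj 2 _), integral_add (hj 0 _) (hj 1 _)]
  simp_rw [integral_const_mul, integral_betaDensity_mul_pow hx]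
  have hn' : (n : ℝ) ≠ 0 := by positivity
  have hxq : (x : ℝ) = q * n := by rw [hq]; field_simp
  have hf (a : ℕ) : (a ! : ℝ) ≠ 0 := by positivity
  simp only [Nat.add_zero, Nat.factorial_succ, Nat.cast_mul, Nat.cast_add, Nat.cast_one,
    Nat.cast_ofNat, hxq, hy]
  have h2 : (n : ℝ) + 2 ≠ 0 := by positivity
  have h3 : (n : ℝ) + 3 ≠ 0 := by positivity
  have h4 : (n : ℝ) + 4 ≠ 0 := by positivity
  field_simp
  ring

theorem integral_betaDensity {n x : ℕ} (hx : x ≤ n) : ∫ p, betaDensity n x p = 1 := by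
  have h := integral_betaDensity_mul_pow hx 0
  simp only [pow_zero, mul_one, add_zero] at h
  rw [h, div_self (by positivity)]

theorem klDiv_nonneg {f g : ℝ → ℝ} (hf : Integrable f) (hg : Integrable g) (hf₀ : ∀ z, 0 ≤ f z)
    (hg₀ : ∀ z, 0 < g z) (hfg : ∫ z, f z = ∫ z, g z) : 0 ≤ klDiv f g := by
  unfold klDiv
  by_cases hi : Integrable fun z => f z * log (f z / g z)
  · calc (0 : ℝ) = ∫ z, (f z - g z) := by rw [integral_sub hf hg, hfg, sub_self]
      _ ≤ ∫ z, f z * log (f z / g z) := by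
        refine integral_mono (hf.sub hg) hi fun z => ?_
        rcases (hf₀ z).eq_or_lt with h | h
        · simpa [← h] using (hg₀ z).le
        · have hl := mul_le_mul_of_nonneg_left
            (one_sub_inv_le_log_of_pos (div_pos h (hg₀ z))) h.le
          refine le_trans (le_of_eq ?_) hl
          field_simp
  · rw [integral_undef hi]

theorem klDiv_le_abs_integral {f g h : ℝ → ℝ} (hh : Integrable fun z => f z * h z)
    (hle : ∀ z, f z * log (f z / g z) ≤ f z * h z) : klDiv f g ≤ |∫ z, f z * h z| := by
  unfold klDiv
  by_cases hi : Integrable fun z => f z * log (f z / g z)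
  · exact (integral_mono hi hh hle).trans (le_abs_self _)
  · rw [integral_undef hi]
    exact abs_nonneg _

theorem stdGaussianDensity_eq_gaussianPDFReal :
    stdGaussianDensity = ProbabilityTheory.gaussianPDFReal 0 1 := by
  funext z
  simp [stdGaussianDensity, ProbabilityTheory.gaussianPDFReal, div_eq_inv_mul]

theorem stdGaussianDensity_pos (z : ℝ) : 0 < stdGaussianDensity z := by
  unfold stdGaussianDensity
  positivity

theorem integrable_stdGaussianDensity : Integrable stdGaussianDensity := by
  rw [stdGaussianDensity_eq_gaussianPDFReal]
  exact ProbabilityTheory.integrable_gaussianPDFReal 0 1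

theorem integral_stdGaussianDensity : ∫ z, stdGaussianDensity z = 1 := by
  rw [stdGaussianDensity_eq_gaussianPDFReal]
  exact ProbabilityTheory.integral_gaussianPDFReal_eq_one 0 one_ne_zero

theorem integral_mul_comp_add_mul {s : ℝ} (hs : 0 < s) (a : ℝ) (g : ℝ → ℝ) :
    ∫ z, s * g (a + s * z) = ∫ p, g p := by
  rw [integral_const_mul, Measure.integral_comp_mul_left (fun t => g (a + t)) s,
    integral_add_left_eq_self g a, abs_of_pos (inv_pos.mpr hs), smul_eq_mul,
    mul_inv_cancel_left₀ hs.ne']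

/-- The value at `p = x / n` of the Beta posterior density, multiplied by `√(2π)` and by the scale
`√(v / n)`. -/
noncomputable def betaPeak (v : ℝ) (n x : ℕ) : ℝ :=
  √v / √n * ((n + 1) * n.choose x * (x / n : ℝ) ^ x * (1 - x / n : ℝ) ^ (n - x)) * √(2 * π)

theorem betaPeak_pos {v : ℝ} (hv : 0 < v) {n x : ℕ} (hxn : x < n) (hx : 0 < x) :
    0 < betaPeak v n x := by
  have hn : (0 : ℝ) < n := by exact_mod_cast hx.trans hxn
  have hc : (0 : ℝ) < n.choose x := by exact_mod_cast Nat.choose_pos hxn.le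
  have h1 : (0 : ℝ) < 1 - x / n := by
    rw [sub_pos, div_lt_one hn]
    exact_mod_cast hxn
  unfold betaPeak
  positivity

theorem factorial_eq_stirlingSeq_mul {n : ℕ} (hn : 0 < n) :
    (n ! : ℝ) = Stirling.stirlingSeq n * (√(2 * n) * (n / exp 1) ^ n) := by
  unfold Stirling.stirlingSeq
  field_simp

theorem betaPeak_eq_stirlingSeq {v : ℝ} {n x : ℕ} (hxn : x < n) (hx : 0 < x) :
    betaPeak v n x = Stirling.stirlingSeq n /
      (Stirling.stirlingSeq x * Stirling.stirlingSeq (n - x)) * (1 + 1 / n) *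
        (√π * √v / (√(x / n) * √(1 - x / n))) := by
  obtain ⟨m, rfl⟩ := Nat.exists_eq_add_of_lt hxn
  rw [show x + m + 1 = x + (m + 1) by ring]
  generalize hk : m + 1 = k
  have hk0 : 0 < k := by omega
  have hsx : 0 < Stirling.stirlingSeq x := by unfold Stirling.stirlingSeq; positivity
  have hsk : 0 < Stirling.stirlingSeq k := by unfold Stirling.stirlingSeq; positivity
  have hq : (1 - x / (x + k : ℕ) : ℝ) = k / (x + k : ℕ) := by
    push_cast
    field_simp
    ring
  unfold betaPeak
  rw [hq, Nat.cast_choose ℝ (Nat.le_add_right x k), Nat.add_sub_cancel_left,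
    factorial_eq_stirlingSeq_mul hx, factorial_eq_stirlingSeq_mul hk0,
    factorial_eq_stirlingSeq_mul (Nat.add_pos_left hx k)]
  have hn : (0 : ℝ) < (x + k : ℕ) := by positivity
  generalize ((x + k : ℕ) : ℝ) = N at *
  have hx' : (0 : ℝ) < x := by positivity
  have hk' : (0 : ℝ) < k := by positivity
  rw [sqrt_mul zero_le_two, sqrt_mul zero_le_two, sqrt_mul zero_le_two, sqrt_mul zero_le_two,
    sqrt_div hx'.le, sqrt_div hk'.le]
  have h2 : √2 ≠ 0 := by positivity
  simp only [div_pow, pow_add]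
  field_simp
  rw [sq_sqrt hn.le]

/-- Upper bound for the log-likelihood ratio of the standardized posterior against the standard
Gaussian, obtained from the cubic Taylor bound on the logarithm at `x / n`. -/
theorem mul_log_div_stdGaussianDensity_le {α : ℝ} (hα : α ∈ Set.Ioo (0 : ℝ) 1) {n x : ℕ}
    (hxn : x < n) (hx : 0 < x) {q v s : ℝ} (hq : q = x / n) (hv : v = α * (1 - α))
    (hs : s = √v / √n) {p z : ℝ} (hp : p = α + s * z) :
    s * betaDensity n x p * log (s * betaDensity n x p / stdGaussianDensity z) ≤
      s * betaDensity n x p * (log (betaPeak v n x) + n * (q - α) ^ 2 / (2 * v)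
        + n * ((q - α) / v * (p - q) + (1 / (2 * v) - 1 / (2 * (q * (1 - q)))) * (p - q) ^ 2
          + (1 / q ^ 2 - 1 / (1 - q) ^ 2) / 3 * (p - q) ^ 3)) := by
  have hn : (0 : ℝ) < n := by exact_mod_cast hx.trans hxn
  have hv0 : 0 < v := hv ▸ mul_pos hα.1 (sub_pos.mpr hα.2)
  have hs0 : 0 < s := by rw [hs]; positivity
  have hq0 : 0 < q := by rw [hq]; positivity
  have hq1 : 0 < 1 - q := by
    rw [hq, sub_pos, div_lt_one hn]
    exact_mod_cast hxn
  rcases (betaDensity_nonneg n x p).eq_or_lt with h0 | h0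
  · simp [← h0]
  refine mul_le_mul_of_nonneg_left ?_ (mul_pos hs0 h0).le
  have hmem : 0 ≤ p ∧ p ≤ 1 := by
    by_contra h
    simp [betaDensity, h] at h0
  have hp0 : 0 < p := by
    refine hmem.1.lt_of_ne fun h => ?_
    simp [betaDensity, ← h, hx.ne'] at h0
  have hp1 : 0 < 1 - p := by
    refine (sub_nonneg.mpr hmem.2).lt_of_ne fun h => ?_
    simp [betaDensity, ← h, (Nat.sub_pos_of_lt hxn).ne'] at h0
  have hratio : s * betaDensity n x p / stdGaussianDensity z =
      betaPeak v n x * ((p / q) ^ x * ((1 - p) / (1 - q)) ^ (n - x) * exp (z ^ 2 / 2)) := by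
    rw [betaDensity, if_pos hmem, stdGaussianDensity, betaPeak, ← hq, ← hs, neg_div, exp_neg]
    simp only [div_pow]
    field_simp
  have hz : z ^ 2 / 2 = n * (p - α) ^ 2 / (2 * v) := by
    have h : s ^ 2 = v / n := by rw [hs, div_pow, sq_sqrt hv0.le, sq_sqrt hn.le]
    rw [hp, add_sub_cancel_left, mul_pow, h]
    field_simp
  have hxq : (x : ℝ) = n * q := by rw [hq]; field_simp
  have hmq : ((n - x : ℕ) : ℝ) = n * (1 - q) := by
    rw [Nat.cast_sub hxn.le, hxq]; ring
  have hlx := mul_le_mul_of_nonneg_left (log_le_cubic (div_pos hp0 hq0)) (mul_pos hn hq0).le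
  have hlm := mul_le_mul_of_nonneg_left (log_le_cubic (div_pos hp1 hq1)) (mul_pos hn hq1).le
  rw [hratio, log_mul (betaPeak_pos hv0 hxn hx).ne' (by positivity),
    log_mul (by positivity) (by positivity), log_mul (by positivity) (by positivity), log_pow,
    log_pow, log_exp, hz, hxq, hmq]
  refine (add_le_add_right (add_le_add_left (add_le_add hlx hlm) _) _).trans (le_of_eq ?_)
  field_simp
  ring

theorem eventually_floor_mem_Ioo {α : ℝ} (hα : α ∈ Set.Ioo (0 : ℝ) 1) :
    ∀ᶠ n : ℕ in atTop, ⌊α * n⌋₊ ∈ Set.Ioo 0 n := by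
  have h : Tendsto (fun n : ℕ => α * (n : ℝ)) atTop atTop :=
    tendsto_natCast_atTop_atTop.const_mul_atTop hα.1
  filter_upwards [h.eventually_ge_atTop 1, eventually_gt_atTop 0] with n hn hn0
  refine ⟨Nat.floor_pos.mpr hn, (Nat.floor_lt (by positivity)).mpr ?_⟩
  exact mul_lt_of_lt_one_left (by exact_mod_cast hn0) hα.2

theorem tendsto_betaPeak_floor {α : ℝ} (hα : α ∈ Set.Ioo (0 : ℝ) 1) :
    Tendsto (fun n : ℕ => betaPeak (α * (1 - α)) n ⌊α * n⌋₊) atTop (𝓝 1) := by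
  have hα1 : 0 < 1 - α := sub_pos.mpr hα.2
  have hq : Tendsto (fun n : ℕ => (⌊α * n⌋₊ / n : ℝ)) atTop (𝓝 α) :=
    (tendsto_nat_floor_mul_div_atTop hα.1.le).comp tendsto_natCast_atTop_atTop
  have hx : Tendsto (fun n : ℕ => ⌊α * n⌋₊) atTop atTop :=
    tendsto_nat_floor_atTop.comp (tendsto_natCast_atTop_atTop.const_mul_atTop hα.1)
  have hm : Tendsto (fun n : ℕ => n - ⌊α * n⌋₊) atTop atTop := by
    refine tendsto_natCast_atTop_iff (R := ℝ).mp (tendsto_atTop_mono (fun n => ?_)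
      (tendsto_natCast_atTop_atTop.const_mul_atTop hα1))
    have h1 : (⌊α * n⌋₊ : ℝ) ≤ α * n := Nat.floor_le (by have := hα.1; positivity)
    have h2 : (n : ℝ) ≤ (n - ⌊α * n⌋₊ : ℕ) + ⌊α * n⌋₊ := by exact_mod_cast le_tsub_add
    linarith
  have hS := Stirling.tendsto_stirlingSeq_sqrt_pi
  have hsα : √α ≠ 0 := (sqrt_pos.mpr hα.1).ne'
  have hsα1 : √(1 - α) ≠ 0 := (sqrt_pos.mpr hα1).ne'
  have hπ : √π ≠ 0 := (sqrt_pos.mpr pi_pos).ne'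
  have hlim := ((hS.div ((hS.comp hx).mul (hS.comp hm)) (mul_ne_zero hπ hπ)).mul
    ((tendsto_one_div_atTop_nhds_zero_nat (𝕜 := ℝ)).const_add 1)).mul
    ((tendsto_const_nhds (x := √π * √(α * (1 - α)))).div
      (hq.sqrt.mul (hq.const_sub 1).sqrt) (mul_ne_zero hsα hsα1))
  have hval : √π / (√π * √π) * (1 + 0) * (√π * √(α * (1 - α)) / (√α * √(1 - α))) = 1 := by
    rw [sqrt_mul hα.1.le]
    field_simp
    ring
  rw [hval] at hlim
  refine hlim.congr' ?_
  filter_upwards [eventually_floor_mem_Ioo hα] with n hn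
  exact (betaPeak_eq_stirlingSeq hn.2 hn.1).symm

theorem tendsto_mul_sq_floor_div_sub {α : ℝ} (hα : 0 ≤ α) :
    Tendsto (fun n : ℕ => n * (⌊α * n⌋₊ / n - α : ℝ) ^ 2) atTop (𝓝 0) := by
  refine squeeze_zero (fun n => by positivity) (fun n => ?_)
    (tendsto_one_div_atTop_nhds_zero_nat (𝕜 := ℝ))
  rcases n.eq_zero_or_pos with rfl | hn
  · simp
  have hn' : (0 : ℝ) < n := by exact_mod_cast hn
  have h1 : (⌊α * n⌋₊ : ℝ) ≤ α * n := Nat.floor_le (by positivity)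
  have h2 := Nat.lt_floor_add_one (α * n)
  have h : n * (⌊α * n⌋₊ / n - α : ℝ) ^ 2 = (⌊α * n⌋₊ - α * n : ℝ) ^ 2 / n := by
    field_simp
  rw [h]
  gcongr
  exact (sq_le_one_iff_abs_le_one _).mpr (abs_le.mpr ⟨by linarith, by linarith⟩)

theorem tendsto_integral_log_ratio_bound {α v : ℝ} (hα : α ∈ Set.Ioo (0 : ℝ) 1)
    (hv : v = α * (1 - α)) {q : ℕ → ℝ} (hq : q = fun n : ℕ => (⌊α * n⌋₊ / n : ℝ)) :
    Tendsto (fun n : ℕ => ∫ p, betaDensity n ⌊α * n⌋₊ p *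
      (log (betaPeak v n ⌊α * n⌋₊) + n * (q n - α) ^ 2 / (2 * v)
        + n * ((q n - α) / v * (p - q n)
          + (1 / (2 * v) - 1 / (2 * (q n * (1 - q n)))) * (p - q n) ^ 2
          + (1 / q n ^ 2 - 1 / (1 - q n) ^ 2) / 3 * (p - q n) ^ 3))) atTop (𝓝 0) := by
  have hα0 : α ≠ 0 := hα.1.ne'
  have hα1 : 1 - α ≠ 0 := (sub_pos.mpr hα.2).ne'
  have hv0 : v ≠ 0 := hv ▸ mul_ne_zero hα0 hα1
  have hqt : Tendsto q atTop (𝓝 α) := hq ▸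
    (tendsto_nat_floor_mul_div_atTop hα.1.le).comp tendsto_natCast_atTop_atTop
  have hyt := tendsto_one_div_atTop_nhds_zero_nat (𝕜 := ℝ)
  have hsq : Tendsto (fun n : ℕ => n * (q n - α) ^ 2 / (2 * v)) atTop (𝓝 0) := by
    simpa [hq] using (tendsto_mul_sq_floor_div_sub hα.1.le).div_const (2 * v)
  have hlog : Tendsto (fun n : ℕ => log (betaPeak v n ⌊α * n⌋₊)) atTop (𝓝 0) := by
    simpa [hv] using (tendsto_betaPeak_floor hα).log one_ne_zero
  have hcont : ContinuousAt (fun w : ℝ × ℝ =>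
      (w.1 - α) / v * ((1 - 2 * w.1) / (1 + 2 * w.2))
        + (1 / (2 * v) - 1 / (2 * (w.1 * (1 - w.1)))) *
          ((w.1 * (1 - w.1) + w.2 * (2 - 6 * w.1 + 6 * w.1 ^ 2)) /
            ((1 + 2 * w.2) * (1 + 3 * w.2)))
        + (1 / w.1 ^ 2 - 1 / (1 - w.1) ^ 2) / 3 *
          (w.2 * (5 * w.1 - 15 * w.1 ^ 2 + 10 * w.1 ^ 3
            + w.2 * (6 - 24 * w.1 + 36 * w.1 ^ 2 - 24 * w.1 ^ 3))
          / ((1 + 2 * w.2) * (1 + 3 * w.2) * (1 + 4 * w.2)))) (α, 0) := by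
    fun_prop (disch := simp [hα0, hα1])
  have hrat := hcont.tendsto.comp (hqt.prodMk_nhds hyt)
  have hlim := (hlog.add hsq).add hrat
  simp only [← hv, sub_self, zero_div, zero_mul, mul_zero, add_zero] at hlim
  refine hlim.congr' ?_
  filter_upwards [eventually_floor_mem_Ioo hα, eventually_gt_atTop 0] with n hn hn0
  rw [integral_betaDensity_mul_cubic hn0 hn.2.le (congrFun hq n) rfl]
  simp only [Function.comp_apply]
  ring

/-- For `α ∈ (0,1)` and `x_n = ⌊αn⌋`, the Kullback–Leibler divergence of the
standard Gaussian density from the density of the standardized variable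
`Z̃_n = √n (α(1-α))^{-1/2} (Z_n - α)` tends to `0`. -/
theorem kl_divergence_to_zero_alpha (α : ℝ) (hα : α ∈ Set.Ioo (0 : ℝ) 1) :
    Tendsto (fun n : ℕ => klDiv (tildeDensityAlpha α n) stdGaussianDensity) atTop
      (nhds 0) := by
  have hα1 : 0 < 1 - α := sub_pos.mpr hα.2
  have hv : 0 < α * (1 - α) := mul_pos hα.1 hα1
  have hlim := (tendsto_integral_log_ratio_bound hα rfl rfl).abs
  rw [abs_zero] at hlim
  have scale_pos : ∀ {n : ℕ}, 0 < n → 0 < √(α * (1 - α)) / √n := fun hn => by positivity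
  refine tendsto_of_tendsto_of_tendsto_of_le_of_le' tendsto_const_nhds hlim ?_ ?_
  · filter_upwards [eventually_floor_mem_Ioo hα, eventually_gt_atTop 0] with n hn hn0
    have hs := scale_pos hn0
    refine klDiv_nonneg ?_ integrable_stdGaussianDensity
      (fun z => mul_nonneg hs.le (betaDensity_nonneg _ _ _)) stdGaussianDensity_pos ?_
    · have hint : Integrable (betaDensity n ⌊α * n⌋₊) := by
        simpa using integrable_betaDensity_mul n ⌊α * n⌋₊ (continuous_const (y := (1 : ℝ)))
      exact ((hint.comp_add_left α).comp_mul_left' hs.ne').const_mul _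
    · rw [integral_stdGaussianDensity, ← integral_betaDensity hn.2.le]
      exact integral_mul_comp_add_mul hs α _
  · filter_upwards [eventually_floor_mem_Ioo hα, eventually_gt_atTop 0] with n hn hn0
    have hs := scale_pos hn0
    rw [← integral_mul_comp_add_mul hs α]
    simp only [← mul_assoc (√(α * (1 - α)) / √(n : ℝ))]
    refine klDiv_le_abs_integral ?_ fun z =>
      mul_log_div_stdGaussianDensity_le hα hn.2 hn.1 rfl rfl rfl rfl
    simp only [tildeDensityAlpha, mul_assoc (√(α * (1 - α)) / √(n : ℝ))]
    refine (((integrable_betaDensity_mul n ⌊α * n⌋₊ (g := fun p => _ + _ * (_ * (p - _) +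
      _ * (p - _) ^ 2 + _ * (p - _) ^ 3)) ?_).comp_add_left α).comp_mul_left' hs.ne').const_mul _
    fun_prop
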